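/- The linear map Π → ℝ⁴ sending P to its pair of diagonal vectors (P_AC, P_BD) is injective and satisfies ⟨P, Q⟩ = (P_AC, P_BD)·(Q_AC, Q_BD) for all P, Q ∈ Π (where the right side is the standard dot product in ℝ⁴); hence it is a linear isometry of Π onto its image. Moreover the linear map Π → ℝ⁴ sending P to its pair of side vectors (P_AB, P_BC) is also injective. In particular an element of Π is uniquely determined by its diagonal vectors, and also by its side vectors. -/

import Mathlib

noncomputable section

open Real Set

/-- Membership predicate for conformally inscribed parallelograms.
Coordinates of `P : Fin 9 → ℝ`:
`0 = x_A, 1 = y_A, 2 = x_B, 3 = y_B, 4 = x_C, 5 = y_C, 6 = x_D, 7 = y_D, 8 = w`.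
The vertex `(x_L, y_L)` lies on the line `L(w)` for `L ∈ {A,B,C,D}` and the
midpoints of the two diagonals coincide. -/
def IsCIP (mA mB mC mD bA : ℝ) (P : Fin 9 → ℝ) : Prop :=
  P 1 = mA * P 0 + bA * P 8 ∧
  P 3 = mB * P 2 + P 8 ∧
  P 5 = mC * P 4 ∧
  P 7 = mD * P 6 ∧
  P 0 + P 4 = P 2 + P 6 ∧
  P 1 + P 5 = P 3 + P 7

/-- `Π`, the set of conformally inscribed parallelograms. -/
def CIP (mA mB mC mD bA : ℝ) : Set (Fin 9 → ℝ) := {P | IsCIP mA mB mC mD bA P}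

/-- The `AC` diagonal vector of a parallelogram. -/
def vAC (P : Fin 9 → ℝ) : ℝ × ℝ := (P 0 - P 4, P 1 - P 5)

/-- The `BD` diagonal vector of a parallelogram. -/
def vBD (P : Fin 9 → ℝ) : ℝ × ℝ := (P 2 - P 6, P 3 - P 7)

/-- The `AB` side vector of a parallelogram. -/
def vAB (P : Fin 9 → ℝ) : ℝ × ℝ := (P 0 - P 2, P 1 - P 3)

/-- The `BC` side vector of a parallelogram. -/
def vBC (P : Fin 9 → ℝ) : ℝ × ℝ := (P 2 - P 4, P 3 - P 5)

/-- Dot product in `ℝ²`. -/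
def dot2 (a b : ℝ × ℝ) : ℝ := a.1 * b.1 + a.2 * b.2

/-- The inner product `⟨P, Q⟩ = P_AC · Q_AC + P_BD · Q_BD` on `Π`. -/
def pinner (P Q : Fin 9 → ℝ) : ℝ := dot2 (vAC P) (vAC Q) + dot2 (vBD P) (vBD Q)

/-- Two conformally inscribed parallelograms that are translates of each other are equal. -/
theorem CIP.eq_of_translate {mA mB mC mD bA : ℝ} (hCD : mC ≠ mD) {P Q : Fin 9 → ℝ}
    (hP : P ∈ CIP mA mB mC mD bA) (hQ : Q ∈ CIP mA mB mC mD bA)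
    (x0 : P 0 - Q 0 = P 4 - Q 4) (x2 : P 2 - Q 2 = P 4 - Q 4) (x6 : P 6 - Q 6 = P 4 - Q 4)
    (y1 : P 1 - Q 1 = P 5 - Q 5) (y3 : P 3 - Q 3 = P 5 - Q 5) (y7 : P 7 - Q 7 = P 5 - Q 5) :
    P = Q := by
  obtain ⟨-, pB, pC, pD, -, -⟩ := hP
  obtain ⟨-, qB, qC, qD, -, -⟩ := hQ
  have h4 : P 4 = Q 4 := by
    have h : (mC - mD) * (P 4 - Q 4) = 0 := by
      linear_combination qC - pC + pD - qD - y7 + mD * x6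
    exact sub_eq_zero.1 ((mul_eq_zero.1 h).resolve_left (sub_ne_zero.2 hCD))
  have h5 : P 5 = Q 5 := by rw [pC, qC, h4]
  have h2 : P 2 = Q 2 := by linarith
  have h8 : P 8 = Q 8 := by
    rw [h2] at pB
    linarith
  ext i
  fin_cases i <;> simp only [Fin.reduceFinMk, Fin.zero_eta, Fin.mk_one] <;> linarith

theorem stmt_6 (mA mB mC mD bA : ℝ) (hCD : mC ≠ mD) :
    Set.InjOn (fun P : Fin 9 → ℝ => (vAC P, vBD P)) (CIP mA mB mC mD bA) ∧
    (∀ P ∈ CIP mA mB mC mD bA, ∀ Q ∈ CIP mA mB mC mD bA,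
        pinner P Q =
          (vAC P).1 * (vAC Q).1 + (vAC P).2 * (vAC Q).2 +
            (vBD P).1 * (vBD Q).1 + (vBD P).2 * (vBD Q).2) ∧
    Set.InjOn (fun P : Fin 9 → ℝ => (vAB P, vBC P)) (CIP mA mB mC mD bA) := by
  refine ⟨fun P hP Q hQ h => ?_, fun P _ Q _ => ?_, fun P hP Q hQ h => ?_⟩
  · simp only [vAC, vBD, Prod.mk.injEq] at h
    obtain ⟨⟨_, _⟩, _, _⟩ := h
    obtain ⟨-, -, -, -, _, _⟩ := id hP
    obtain ⟨-, -, -, -, _, _⟩ := id hQ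
    apply CIP.eq_of_translate hCD hP hQ <;> linarith
  · simp only [pinner, dot2]
    ring
  · simp only [vAB, vBC, Prod.mk.injEq] at h
    obtain ⟨⟨_, _⟩, _, _⟩ := h
    obtain ⟨-, -, -, -, _, _⟩ := id hP
    obtain ⟨-, -, -, -, _, _⟩ := id hQ
    apply CIP.eq_of_translate hCD hP hQ <;> linarith
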